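/- arXiv:1607.08338 — 2 statements merged into one kernel-verified Lean document; each statement's English description precedes it below -/
import Mathlib

section
/- Let k ∈ ℕ and let R = { (x, y) ∈ ℝ^n × ℝ^n : 0 ≤ y_i ≤ x_i ≤ 1 for all i, Σ_{i=1}^n w_i x_i − Σ_{i=1}^n w̄_i y_i ≤ B, Σ_{i=1}^n y_i ≤ k }. Then every extreme point (x, y) of R has at most two non-integral items, i.e., |{ i : (x_i, y_i) ∉ {0,1}×{0,1} }| ≤ 2; moreover, if an extreme point has exactly two non-integral items i and j, then Σ_{ℓ=1}^n y_ℓ = k and y_i + y_j = 1. -/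
open Filter Topology

section ImprovementPolytope

variable {ι : Type*} [Fintype ι]

/-- The LP relaxation of the improvement knapsack problem with unit improvement costs. -/
def improvementPolytope (w wbar : ι → ℝ) (B k : ℝ) : Set ((ι → ℝ) × (ι → ℝ)) :=
  {z | (∀ i, 0 ≤ z.2 i ∧ z.2 i ≤ z.1 i ∧ z.1 i ≤ 1) ∧
    (∑ i, w i * z.1 i) - (∑ i, wbar i * z.2 i) ≤ B ∧ (∑ i, z.2 i) ≤ k}

lemma eventually_nonneg_add_mul {a b : ℝ} (ha : 0 ≤ a) (hab : a = 0 → b = 0) :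
    ∀ᶠ ε in 𝓝 (0 : ℝ), 0 ≤ a + ε * b := by
  rcases ha.eq_or_lt with h | h
  · simp [← h, hab h.symm]
  · have hc : ContinuousAt (fun ε : ℝ => a + ε * b) 0 := by fun_prop
    exact (hc.eventually (lt_mem_nhds (by simpa using h))).mono fun _ h => h.le

/-- Moving a little from a point of the polytope along a direction that respects the tight
constraints stays in the polytope. -/
lemma eventually_add_smul_mem_improvementPolytope {w wbar : ι → ℝ} {B k : ℝ}
    {z d : (ι → ℝ) × (ι → ℝ)} (hz : z ∈ improvementPolytope w wbar B k)
    (h0 : ∀ i, z.2 i = 0 → d.2 i = 0) (hxy : ∀ i, z.2 i = z.1 i → d.2 i = d.1 i)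
    (h1 : ∀ i, z.1 i = 1 → d.1 i = 0)
    (hB : ∑ i, (w i * d.1 i - wbar i * d.2 i) = 0)
    (hk : ∑ i, z.2 i = k → ∑ i, d.2 i = 0) :
    ∀ᶠ ε in 𝓝 (0 : ℝ), z + ε • d ∈ improvementPolytope w wbar B k := by
  obtain ⟨hz₁, hz₂, hz₃⟩ := hz
  have e0 := eventually_all.2 fun i => eventually_nonneg_add_mul (hz₁ i).1 (h0 i)
  have exy := eventually_all.2 fun i =>
    eventually_nonneg_add_mul (b := d.1 i - d.2 i) (sub_nonneg.2 (hz₁ i).2.1)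
      fun h => by linarith [hxy i (by linarith)]
  have e1 := eventually_all.2 fun i =>
    eventually_nonneg_add_mul (b := -d.1 i) (sub_nonneg.2 (hz₁ i).2.2)
      fun h => by linarith [h1 i (by linarith)]
  have ek := eventually_nonneg_add_mul (b := -∑ i, d.2 i) (sub_nonneg.2 hz₃)
      fun h => by linarith [hk (by linarith)]
  filter_upwards [e0, exy, e1, ek] with ε e0 exy e1 ek
  refine ⟨fun i => ⟨?_, ?_, ?_⟩, ?_, ?_⟩
  · simpa using e0 i
  · have := exy i
    simp only [Prod.fst_add, Prod.snd_add, Prod.smul_fst, Prod.smul_snd, Pi.add_apply,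
      Pi.smul_apply, smul_eq_mul]
    linarith
  · have := e1 i
    simp only [Prod.fst_add, Prod.smul_fst, Pi.add_apply, Pi.smul_apply, smul_eq_mul]
    linarith
  · have h : (∑ i, w i * (z + ε • d).1 i) - (∑ i, wbar i * (z + ε • d).2 i) =
        ((∑ i, w i * z.1 i) - ∑ i, wbar i * z.2 i) +
          ε * ∑ i, (w i * d.1 i - wbar i * d.2 i) := by
      simp only [Finset.mul_sum, ← Finset.sum_sub_distrib, ← Finset.sum_add_distrib]
      refine Finset.sum_congr rfl fun i _ => ?_
      simp only [Prod.fst_add, Prod.snd_add, Prod.smul_fst, Prod.smul_snd, Pi.add_apply,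
        Pi.smul_apply, smul_eq_mul]
      ring
    rw [h, hB]
    simpa using hz₂
  · have h : ∑ i, (z + ε • d).2 i = (∑ i, z.2 i) + ε * ∑ i, d.2 i := by
      simp [Finset.mul_sum, Finset.sum_add_distrib]
    rw [h]
    linarith

lemma direction_eq_zero_of_mem_extremePoints {w wbar : ι → ℝ} {B k : ℝ}
    {z d : (ι → ℝ) × (ι → ℝ)} (hz : z ∈ (improvementPolytope w wbar B k).extremePoints ℝ)
    (h0 : ∀ i, z.2 i = 0 → d.2 i = 0) (hxy : ∀ i, z.2 i = z.1 i → d.2 i = d.1 i)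
    (h1 : ∀ i, z.1 i = 1 → d.1 i = 0)
    (hB : ∑ i, (w i * d.1 i - wbar i * d.2 i) = 0)
    (hk : ∑ i, z.2 i = k → ∑ i, d.2 i = 0) : d = 0 := by
  have hpos := eventually_add_smul_mem_improvementPolytope hz.1 h0 hxy h1 hB hk
  have hneg : ∀ᶠ ε in 𝓝 (0 : ℝ), z + (-ε) • d ∈ improvementPolytope w wbar B k :=
    (continuous_neg.tendsto' (0 : ℝ) 0 neg_zero).eventually hpos
  obtain ⟨ε, ⟨hp, hn⟩, hε⟩ :=
    (((hpos.and hneg).filter_mono nhdsWithin_le_nhds).and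
      (self_mem_nhdsWithin (s := Set.Ioi (0 : ℝ)))).exists
  have hseg : z ∈ openSegment ℝ (z + ε • d) (z + (-ε) • d) :=
    ⟨1 / 2, 1 / 2, by norm_num, by norm_num, by norm_num, by module⟩
  have h : z + ε • d = z := hz.2 hp hn hseg
  exact (smul_eq_zero.1 (add_eq_left.1 h)).resolve_left (ne_of_gt hε)

/-- Each item admits a direction respecting its tight constraints, nonzero if the item is
non-integral. -/
lemma exists_item_direction {x y : ℝ} :
    ∃ a b : ℝ, (y = 0 → b = 0) ∧ (y = x → b = a) ∧ (x = 1 → a = 0) ∧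
      (¬ ((x = 0 ∨ x = 1) ∧ (y = 0 ∨ y = 1)) → ¬ (a = 0 ∧ b = 0)) := by
  by_cases hx : x = 1
  · by_cases hy : y = 0 ∨ y = 1
    · exact ⟨0, 0, by simp [hx, hy]⟩
    · exact ⟨0, 1, by grind⟩
  · by_cases hy : y = x
    · by_cases hx0 : x = 0
      · exact ⟨0, 0, by simp [hx0, hy]⟩
      · exact ⟨1, 1, by grind⟩
    · exact ⟨1, 0, by grind⟩

end ImprovementPolytope

lemma exists_pair_ne_zero_mul_add_mul_eq_zero (p q : ℝ) :
    ∃ s t : ℝ, ¬ (s = 0 ∧ t = 0) ∧ s * p + t * q = 0 := by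
  by_cases h : p = 0
  · exact ⟨1, 0, by simp [h]⟩
  · exact ⟨q, -p, by simp [h], by ring⟩

/-- Let `k ∈ ℕ` and let `R` be the feasible polytope of the LP
relaxation of (iK-ds) with unit improvement costs, i.e.
`R = {(x,y) : 0 ≤ y i ≤ x i ≤ 1 ∀i, ∑ w i x i - ∑ w̄ i y i ≤ B, ∑ y i ≤ k}`.
Then every extreme point `(x, y)` of `R` has at most two non-integral items; moreover,
if an extreme point has exactly two non-integral items `i` and `j`, then `∑ y = k` and
`y i + y j = 1`. -/
theorem stmt_15 (n : ℕ) (hn : 1 ≤ n)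
    (w wbar : Fin n → ℝ) (B : ℝ) (k : ℕ)
    (R : Set ((Fin n → ℝ) × (Fin n → ℝ)))
    (hR : R = {z | (∀ i, 0 ≤ z.2 i ∧ z.2 i ≤ z.1 i ∧ z.1 i ≤ 1) ∧
      (∑ i, w i * z.1 i) - (∑ i, wbar i * z.2 i) ≤ B ∧
      (∑ i, z.2 i) ≤ (k : ℝ)})
    (z : (Fin n → ℝ) × (Fin n → ℝ)) (hz : z ∈ R.extremePoints ℝ) :
    {i : Fin n | ¬ ((z.1 i = 0 ∨ z.1 i = 1) ∧ (z.2 i = 0 ∨ z.2 i = 1))}.ncard ≤ 2 ∧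
    ∀ i j : Fin n, i ≠ j →
      {t : Fin n | ¬ ((z.1 t = 0 ∨ z.1 t = 1) ∧ (z.2 t = 0 ∨ z.2 t = 1))} = {i, j} →
      (∑ t, z.2 t) = (k : ℝ) ∧ z.2 i + z.2 j = 1 := by
  have hR' : R = improvementPolytope w wbar B k := hR
  subst hR'
  choose a b hb0 hba ha1 hab using fun i => exists_item_direction (x := z.1 i) (y := z.2 i)
  set S := {i : Fin n | ¬ ((z.1 i = 0 ∨ z.1 i = 1) ∧ (z.2 i = 0 ∨ z.2 i = 1))} with hS
  have key : ∀ c : Fin n → ℝ, ∑ i, c i * (w i * a i - wbar i * b i) = 0 →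
      (∑ i, z.2 i = k → ∑ i, c i * b i = 0) → ∀ i ∈ S, c i = 0 := by
    intro c hB hk i hi
    have hd := direction_eq_zero_of_mem_extremePoints
      (d := (fun i => c i * a i, fun i => c i * b i)) hz
      (fun i h => by simp [hb0 i h]) (fun i h => by simp [hba i h])
      (fun i h => by simp [ha1 i h])
      (by rw [← hB]; exact Finset.sum_congr rfl fun i _ => by ring) hk
    have h₁ : c i * a i = 0 := congrFun (congrArg Prod.fst hd) i
    have h₂ : c i * b i = 0 := congrFun (congrArg Prod.snd hd) i
    by_contra hc
    exact hab i hi ⟨(mul_eq_zero.1 h₁).resolve_left hc, (mul_eq_zero.1 h₂).resolve_left hc⟩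
  refine ⟨?_, ?_⟩
  · let v : Fin n → Fin 2 → ℝ := fun i => ![w i * a i - wbar i * b i, b i]
    have hli : LinearIndepOn ℝ v S := by
      rw [linearIndepOn_iff]
      intro l hl hsum
      rw [Finsupp.linearCombination_apply, Finsupp.sum_fintype _ _ (by simp)] at hsum
      have h := key l (by simpa [v] using congrFun hsum 0)
        (fun _ => by simpa [v] using congrFun hsum 1)
      ext i
      by_cases hi : i ∈ S
      · exact h i hi
      · exact Finsupp.notMem_support_iff.1 fun h => hi (hl h)
    have := hli.fintype_card_le_finrank
    rwa [Module.finrank_fin_fun, Fintype.card_eq_nat_card, Nat.card_coe_set_eq] at this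
  · intro i j hij hSij
    have hi : i ∈ S := by simp [hSij]
    have hj : j ∈ S := by simp [hSij]
    have hcard : ¬ (∑ t, z.2 t = k → b i = 0 ∧ b j = 0) := by
      intro h
      obtain ⟨s, t, hst, hsum⟩ := exists_pair_ne_zero_mul_add_mul_eq_zero
        (w i * a i - wbar i * b i) (w j * a j - wbar j * b j)
      have hc := key (Pi.single i s + Pi.single j t)
        (by simpa [add_mul, Finset.sum_add_distrib, Pi.single_apply] using hsum)
        (fun hk => by simp [add_mul, Finset.sum_add_distrib, Pi.single_apply, h hk])
      exact hst ⟨by simpa [hij] using hc i hi, by simpa [hij.symm] using hc j hj⟩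
    rw [Classical.not_imp] at hcard
    obtain ⟨hk, hb⟩ := hcard
    refine ⟨hk, ?_⟩
    have hint : ∀ t, t ≠ i → t ≠ j → ∃ m : ℤ, z.2 t = m := by
      intro t hti htj
      have ht : t ∉ S := by simp [hSij, hti, htj]
      rcases (not_not.1 ht).2 with h | h
      · exact ⟨0, by simpa using h⟩
      · exact ⟨1, by simpa using h⟩
    obtain ⟨m, hm⟩ : ∃ m : ℤ, z.2 i + z.2 j = m := by
      have : ∀ t, ∃ m : ℤ, t ≠ i → t ≠ j → z.2 t = m := fun t => by
        by_cases h : t ≠ i ∧ t ≠ j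
        · exact (hint t h.1 h.2).imp fun _ h _ _ => h
        · exact ⟨0, fun h₁ h₂ => (h ⟨h₁, h₂⟩).elim⟩
      choose m hm using this
      refine ⟨k - ∑ t ∈ {i, j}ᶜ, m t, ?_⟩
      have hsplit := Finset.sum_add_sum_compl {i, j} z.2
      rw [Finset.sum_pair hij, hk] at hsplit
      have hrest : ∑ t ∈ {i, j}ᶜ, z.2 t = ∑ t ∈ {i, j}ᶜ, (m t : ℝ) :=
        Finset.sum_congr rfl fun t ht => by
          simp only [Finset.mem_compl, Finset.mem_insert, Finset.mem_singleton, not_or] at ht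
          exact hm t ht.1 ht.2
      push_cast
      linarith
    have hbound : ∀ t ∈ S, 0 ≤ z.2 t ∧ z.2 t < 1 := by
      intro t ht
      obtain ⟨h0, hxy, h1⟩ := hz.1.1 t
      refine ⟨h0, lt_of_le_of_ne (hxy.trans h1) fun h => ht ⟨Or.inr ?_, Or.inr h⟩⟩
      linarith
    obtain ⟨hi0, hi1⟩ := hbound i hi
    obtain ⟨hj0, hj1⟩ := hbound j hj
    have hlt : m < 2 := by exact_mod_cast (by linarith : (m : ℝ) < 2)
    have hgt : 0 < m := by
      have : (0 : ℝ) < m := by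
        rw [← hm]
        refine lt_of_le_of_ne (by linarith) fun h => hb ⟨hb0 i ?_, hb0 j ?_⟩ <;> linarith
      exact_mod_cast this
    rw [hm, show m = 1 by omega, Int.cast_one]
end

section
/- Consider (iK-ds) with unit improvement costs c_i = 1 and improvement budget C = k ∈ ℕ, k ≥ 1, and assume p_i ≥ 0, 0 ≤ w̄_i ≤ w_i and w_i − w̄_i ≤ B for all i. Let (x, y) be an extreme point of the polytope R = { (x, y) ∈ ℝ^{2n} : 0 ≤ y_i ≤ x_i ≤ 1 for all i, Σ_i w_i x_i − Σ_i w̄_i y_i ≤ B, Σ_i y_i ≤ k } with Σ_i p_i x_i ≥ OPT, where OPT is the optimal value of (iK-ds). Let T be the set of items i with (x_i, y_i) ∈ {0,1}×{0,1} and let F be the remaining items, so |F| ≤ 2. Then: if F = ∅, then (x, y) itself is an optimal integral solution; if F = {i}, then the integral solution given by (x_t, y_t) for t ∈ T, together with the solution packing item i alone in improved form, are both feasible for (iK-ds) and the larger of their values is at least OPT/2; and if F = {i, j} with w_i − w̄_i ≤ w_j − w̄_j, then the integral solution given by (x_t, y_t) for t ∈ T together with item i packed in improved form, and the solution packing item j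 alone in improved form, are both feasible for (iK-ds) and the larger of their values is at least OPT/2. -/
open Filter Topology in
/-- A direction along which one can move a little both ways from an extreme point is zero. -/
theorem eq_zero_of_eventually_mem_of_mem_extremePoints {E : Type*} [AddCommGroup E] [Module ℝ E]
    {R : Set E} {z d : E} (hz : z ∈ R.extremePoints ℝ)
    (hd : ∀ᶠ ε in 𝓝 (0 : ℝ), z + ε • d ∈ R) : d = 0 := by
  have hneg : ∀ᶠ ε in 𝓝 (0 : ℝ), z + (-ε) • d ∈ R := by
    have h : Tendsto (fun ε : ℝ => -ε) (𝓝 0) (𝓝 0) := by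
      simpa using (continuous_neg (G := ℝ)).tendsto 0
    exact h.eventually hd
  obtain ⟨ε, ⟨h₁, h₂⟩, hε⟩ :=
    (((hd.and hneg).filter_mono nhdsWithin_le_nhds).and
      (self_mem_nhdsWithin : ∀ᶠ ε in 𝓝[>] (0 : ℝ), ε ∈ Set.Ioi 0)).exists
  have hmem : z ∈ openSegment ℝ (z + ε • d) (z + (-ε) • d) :=
    ⟨1 / 2, 1 / 2, by norm_num, by norm_num, by norm_num, by module⟩
  have h := hz.2 h₁ h₂ hmem
  have h0 : ε • d = 0 := by simpa using h
  exact (smul_eq_zero.1 h0).resolve_left (ne_of_gt hε)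

open Filter Topology in
/-- For `0 ≤ s ≤ r` with `0 < r < 1`, moving `r` freely while keeping `s = 0`, or moving it
along with `s ≠ 0`, preserves the constraints `0 ≤ s ≤ r ≤ 1` locally. -/
theorem eventually_box_constraints {r s : ℝ} (hs : 0 ≤ s) (hsr : s ≤ r) (hr : 0 < r) (hr1 : r < 1)
    (a : ℝ) :
    ∀ᶠ ε in 𝓝 (0 : ℝ), 0 ≤ s + ε * (if s = 0 then 0 else a) ∧
      s + ε * (if s = 0 then 0 else a) ≤ r + ε * a ∧ r + ε * a ≤ 1 := by
  have hcont : ∀ c : ℝ, Tendsto (fun ε : ℝ => c + ε * a) (𝓝 0) (𝓝 c) := fun c => by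
    have : Continuous fun ε : ℝ => c + ε * a := by fun_prop
    simpa using this.tendsto 0
  have h1 := (hcont r).eventually (gt_mem_nhds hr1)
  by_cases h : s = 0
  · filter_upwards [h1, (hcont r).eventually (lt_mem_nhds hr)] with ε h1 h2
    simp only [h, if_true]
    exact ⟨by simp, by linarith, h1.le⟩
  · filter_upwards [h1, (hcont s).eventually (lt_mem_nhds (lt_of_le_of_ne hs (Ne.symm h)))]
      with ε h1 h2
    simp only [h, if_false]
    exact ⟨h2.le, by linarith, h1.le⟩

/-- A homogeneous linear equation in two unknowns has a nontrivial solution. -/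
theorem exists_nontrivial_mul_add_mul_eq_zero (α β : ℝ) :
    ∃ a b : ℝ, (a ≠ 0 ∨ b ≠ 0) ∧ a * α + b * β = 0 := by
  by_cases h : β = 0
  · by_cases h' : α = 0
    · exact ⟨1, 0, by simp, by simp [h']⟩
    · exact ⟨0, 1, by simp, by simp [h]⟩
  · exact ⟨β, -α, Or.inl h, by ring⟩

/-- The linear programming relaxation of the improvable knapsack problem with unit improvement
costs. -/
def relaxedKnapsack {ι : Type*} [Fintype ι] (w wbar : ι → ℝ) (B k : ℝ) :
    Set ((ι → ℝ) × (ι → ℝ)) :=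
  {z | (∀ i, 0 ≤ z.2 i ∧ z.2 i ≤ z.1 i ∧ z.1 i ≤ 1) ∧
    (∑ i, w i * z.1 i) - (∑ i, wbar i * z.2 i) ≤ B ∧ (∑ i, z.2 i) ≤ k}

open Filter Topology in
/-- An extreme point of the relaxation with two items fractionally packed has a tight improvement
budget, and improves one of these two items at least partially. -/
theorem relaxedKnapsack_extremePoints_tight {ι : Type*} [Fintype ι] [DecidableEq ι]
    {w wbar : ι → ℝ} {B k : ℝ} {x y : ι → ℝ}
    (hext : (x, y) ∈ (relaxedKnapsack w wbar B k).extremePoints ℝ) {i j : ι} (hij : i ≠ j)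
    (hi : 0 < x i) (hi1 : x i < 1) (hj : 0 < x j) (hj1 : x j < 1) :
    k ≤ ∑ t, y t ∧ ¬ (y i = 0 ∧ y j = 0) := by
  by_contra hcon
  obtain ⟨hbox, hweight, hcard⟩ := hext.1
  simp only at hbox hweight hcard
  obtain ⟨a, b, hab, h0⟩ := exists_nontrivial_mul_add_mul_eq_zero
    (w i - if y i = 0 then 0 else wbar i) (w j - if y j = 0 then 0 else wbar j)
  set a' : ℝ := if y i = 0 then 0 else a with ha'
  set b' : ℝ := if y j = 0 then 0 else b with hb'
  have h0' : w i * a + w j * b - (wbar i * a' + wbar j * b') = 0 := by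
    rw [← h0, ha', hb']
    split_ifs <;> ring
  have hcard' : ∀ᶠ ε in 𝓝 (0 : ℝ), (∑ t, y t) + ε * (a' + b') ≤ k := by
    by_cases hy : y i = 0 ∧ y j = 0
    · simp [ha', hb', hy.1, hy.2, hcard]
    · have hlt : ∑ t, y t < k := by
        by_contra h
        exact hcon ⟨not_lt.1 h, hy⟩
      have hc : Continuous fun ε : ℝ => (∑ t, y t) + ε * (a' + b') := by fun_prop
      have ht : Tendsto (fun ε : ℝ => (∑ t, y t) + ε * (a' + b')) (𝓝 0) (𝓝 (∑ t, y t)) := by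
        simpa using hc.tendsto 0
      exact (ht.eventually (gt_mem_nhds hlt)).mono fun _ h => le_of_lt h
  have hsum : ∀ (f z : ι → ℝ) (ε c d : ℝ),
      ∑ t, f t * (z t + ε * ((Pi.single i c : ι → ℝ) t + (Pi.single j d : ι → ℝ) t)) =
        ∑ t, f t * z t + ε * (f i * c + f j * d) := by
    intro f z ε c d
    have hs : ∀ (l : ι) (e : ℝ), ∑ t, f t * (Pi.single l e : ι → ℝ) t = f l * e := by
      intro l e
      simp [Pi.single_apply]
    rw [← hs i c, ← hs j d, ← Finset.sum_add_distrib, Finset.mul_sum, ← Finset.sum_add_distrib]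
    exact Finset.sum_congr rfl fun t _ => by ring
  have hd := eq_zero_of_eventually_mem_of_mem_extremePoints
    (d := ((Pi.single i a + Pi.single j b : ι → ℝ), (Pi.single i a' + Pi.single j b' : ι → ℝ)))
    hext (by
      filter_upwards [hcard', eventually_box_constraints (hbox i).1 (hbox i).2.1 hi hi1 a,
        eventually_box_constraints (hbox j).1 (hbox j).2.1 hj hj1 b] with ε h1 h2 h3
      refine ⟨fun t => ?_, ?_, ?_⟩
      · by_cases hti : t = i
        · subst hti
          rw [← ha'] at h2
          simpa [hij] using h2
        · by_cases htj : t = j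
          · subst htj
            rw [← hb'] at h3
            simpa [hij.symm] using h3
          · simpa [hti, htj] using hbox t
      · simp only [Prod.fst_add, Prod.smul_fst, Prod.snd_add, Prod.smul_snd, Pi.add_apply,
          Pi.smul_apply, smul_eq_mul, hsum]
        linear_combination hweight + ε * h0'
      · have h := hsum 1 y ε a' b'
        simp only [Pi.one_apply, one_mul] at h
        simpa only [Prod.snd_add, Prod.smul_snd, Pi.add_apply, Pi.smul_apply, smul_eq_mul, h]
          using h1)
  rw [Prod.mk_eq_zero] at hd
  have hda : a = 0 := by simpa [hij] using congrFun hd.1 i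
  have hdb : b = 0 := by simpa [hij.symm] using congrFun hd.1 j
  exact hab.elim (· hda) (· hdb)

/-- A weighted sum of a function that is `0` or `1` outside of `S`. -/
theorem sum_mul_eq_sum_filter_add_sum {ι : Type*} [Fintype ι] [DecidableEq ι] (f x : ι → ℝ)
    (S : Finset ι) (hx : ∀ t, t ∉ S → x t = 0 ∨ x t = 1) :
    ∑ t, f t * x t =
      ∑ t ∈ Finset.univ.filter (fun t => t ∉ S ∧ x t = 1), f t + ∑ t ∈ S, f t * x t := by
  rw [← Finset.sum_compl_add_sum S, Finset.sum_filter, ← Finset.sum_compl_add_sum S (ι := ι)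
    (f := fun t => if t ∉ S ∧ x t = 1 then f t else 0)]
  have hS : ∑ t ∈ S, (if t ∉ S ∧ x t = 1 then f t else 0) = 0 :=
    Finset.sum_eq_zero fun t ht => by simp [ht]
  rw [hS, add_zero]
  congr 1
  refine Finset.sum_congr rfl fun t ht => ?_
  rw [Finset.mem_compl] at ht
  rcases hx t ht with h | h <;> simp [ht, h]


/-- Consider (iK-ds) with unit improvement costs and improvement budget
`C = k ∈ ℕ`, `k ≥ 1`; assume `p i ≥ 0`, `0 ≤ w̄ i ≤ w i` and `w i - w̄ i ≤ B` for all `i`.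
A feasible solution is a pair of sets `(A, Aim)` with `Aim ⊆ A` (packed, resp. improved
items), `∑_{A} w - ∑_{Aim} w̄ ≤ B` and `|Aim| ≤ k`; its value is `∑_{A} p`, and `OPT` is
the optimal value.  Let `(x, y)` be an extreme point of the LP polytope `R` with
`∑ p i x i ≥ OPT`, let `T` be its set of integral items and `F` the rest.  Then:
if `F = ∅`, `(x, y)` itself is an optimal integral solution; if `F = {i}`, the integral
solution restricted to `T` and the solution packing `i` alone improved are feasible and
the larger value is `≥ OPT/2`; if `F = {i, j}` with `w i - w̄ i ≤ w j - w̄ j`, the integral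
solution restricted to `T` together with `i` improved, and the solution packing `j`
alone improved, are feasible and the larger value is `≥ OPT/2`. -/
theorem stmt_16 (n : ℕ) (hn : 1 ≤ n)
    (p w wbar : Fin n → ℝ) (B : ℝ) (k : ℕ) (hk : 1 ≤ k)
    (hp : ∀ i, 0 ≤ p i) (hw : ∀ i, 0 ≤ wbar i ∧ wbar i ≤ w i)
    (hwB : ∀ i, w i - wbar i ≤ B) (hB : 0 ≤ B)
    (Feas : Finset (Fin n) → Finset (Fin n) → Prop)
    (hFeas : ∀ A Aim, Feas A Aim ↔ (Aim ⊆ A ∧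
      (∑ i ∈ A, w i) - (∑ i ∈ Aim, wbar i) ≤ B ∧ Aim.card ≤ k))
    (OPT : ℝ)
    (hOPT : IsGreatest {v : ℝ | ∃ A Aim, Feas A Aim ∧ v = ∑ i ∈ A, p i} OPT)
    (R : Set ((Fin n → ℝ) × (Fin n → ℝ)))
    (hR : R = {z | (∀ i, 0 ≤ z.2 i ∧ z.2 i ≤ z.1 i ∧ z.1 i ≤ 1) ∧
      (∑ i, w i * z.1 i) - (∑ i, wbar i * z.2 i) ≤ B ∧
      (∑ i, z.2 i) ≤ (k : ℝ)})
    (x y : Fin n → ℝ) (hext : (x, y) ∈ R.extremePoints ℝ)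
    (hval : OPT ≤ ∑ i, p i * x i) :
    -- case F = ∅ : (x, y) itself is an optimal integral solution
    ((∀ t, (x t = 0 ∨ x t = 1) ∧ (y t = 0 ∨ y t = 1)) →
      Feas (Finset.univ.filter fun t => x t = 1) (Finset.univ.filter fun t => y t = 1) ∧
      (∑ t ∈ Finset.univ.filter (fun t => x t = 1), p t) = OPT) ∧
    -- case F = {i}
    (∀ i : Fin n,
      ¬ ((x i = 0 ∨ x i = 1) ∧ (y i = 0 ∨ y i = 1)) →
      (∀ t, t ≠ i → (x t = 0 ∨ x t = 1) ∧ (y t = 0 ∨ y t = 1)) →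
      Feas (Finset.univ.filter fun t => t ≠ i ∧ x t = 1)
           (Finset.univ.filter fun t => t ≠ i ∧ y t = 1) ∧
      Feas {i} {i} ∧
      OPT / 2 ≤ max (∑ t ∈ Finset.univ.filter (fun t => t ≠ i ∧ x t = 1), p t) (p i)) ∧
    -- case F = {i, j} with w i - w̄ i ≤ w j - w̄ j
    (∀ i j : Fin n, i ≠ j → w i - wbar i ≤ w j - wbar j →
      ¬ ((x i = 0 ∨ x i = 1) ∧ (y i = 0 ∨ y i = 1)) →
      ¬ ((x j = 0 ∨ x j = 1) ∧ (y j = 0 ∨ y j = 1)) →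
      (∀ t, t ≠ i → t ≠ j → (x t = 0 ∨ x t = 1) ∧ (y t = 0 ∨ y t = 1)) →
      Feas (insert i (Finset.univ.filter fun t => t ≠ i ∧ t ≠ j ∧ x t = 1))
           (insert i (Finset.univ.filter fun t => t ≠ i ∧ t ≠ j ∧ y t = 1)) ∧
      Feas {j} {j} ∧
      OPT / 2 ≤ max
        (∑ t ∈ insert i (Finset.univ.filter fun t => t ≠ i ∧ t ≠ j ∧ x t = 1), p t)
        (p j)) := by
  change R = relaxedKnapsack w wbar B k at hR
  subst hR
  obtain ⟨hbox, hweight, hcard⟩ := hext.1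
  simp only at hbox hweight hcard
  have hsub : ∀ t, y t = 1 → x t = 1 := fun t ht => by
    have := hbox t
    linarith
  have hle : ∀ t, (w t - wbar t) * x t ≤ w t * x t - wbar t * y t := fun t => by
    linarith [mul_le_mul_of_nonneg_left (hbox t).2.1 (hw t).1]
  have hnonneg : ∀ t, 0 ≤ w t * x t - wbar t * y t := fun t =>
    (mul_nonneg (sub_nonneg.2 (hw t).2) ((hbox t).1.trans (hbox t).2.1)).trans (hle t)
  have hpx : ∀ t, p t * x t ≤ p t := fun t => mul_le_of_le_one_right (hp t) (hbox t).2.2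
  have hsingle : ∀ i, Feas {i} {i} := fun i => (hFeas _ _).2
    ⟨subset_rfl, by simpa using hwB i, by simpa using hk⟩
  have hmax : ∀ {a b : ℝ}, OPT ≤ a + b → OPT / 2 ≤ max a b := fun {a b} h => by
    linarith [le_max_left a b, le_max_right a b]
  refine ⟨fun hint => ?_, fun i _ hint => ?_, fun i j hij hwij hi hj hint => ?_⟩
  · have hx := fun f => sum_mul_eq_sum_filter_add_sum f x ∅ fun t _ => (hint t).1
    have hy := fun f => sum_mul_eq_sum_filter_add_sum f y ∅ fun t _ => (hint t).2
    have hc := hy 1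
    simp only [Finset.notMem_empty, not_false_eq_true, true_and, Finset.sum_empty, add_zero,
      Pi.one_apply, one_mul, Finset.sum_const, nsmul_eq_mul, mul_one] at hx hy hc
    have hF : Feas (Finset.univ.filter fun t => x t = 1) (Finset.univ.filter fun t => y t = 1) := by
      refine (hFeas _ _).2 ⟨Finset.monotone_filter_right _ fun t _ => hsub t, ?_, ?_⟩
      · rw [← hx, ← hy]
        exact hweight
      · rw [hc] at hcard
        exact_mod_cast hcard
    exact ⟨hF, le_antisymm (hOPT.2 ⟨_, _, hF, rfl⟩) (by rw [← hx]; exact hval)⟩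
  · have hx := fun f => sum_mul_eq_sum_filter_add_sum f x {i} fun t ht =>
      (hint t (by simpa using ht)).1
    have hy := fun f => sum_mul_eq_sum_filter_add_sum f y {i} fun t ht =>
      (hint t (by simpa using ht)).2
    have hc := hy 1
    simp only [Finset.mem_singleton, Finset.sum_singleton, ← ne_eq, Pi.one_apply, one_mul,
      Finset.sum_const, nsmul_eq_mul, mul_one] at hx hy hc
    refine ⟨(hFeas _ _).2 ⟨Finset.monotone_filter_right _ fun t _ h => ⟨h.1, hsub t h.2⟩,
      ?_, ?_⟩, hsingle i, hmax ?_⟩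
    · rw [hx, hy] at hweight
      linarith [hnonneg i]
    · rw [hc] at hcard
      have := (hbox i).1
      exact_mod_cast (by linarith : ((Finset.univ.filter fun t => t ≠ i ∧ y t = 1).card : ℝ) ≤ k)
    · rw [hx] at hval
      linarith [hpx i]
  · have hx := fun f => sum_mul_eq_sum_filter_add_sum f x {i, j} fun t ht => by
      rw [Finset.mem_insert, Finset.mem_singleton, not_or] at ht
      exact (hint t ht.1 ht.2).1
    have hy := fun f => sum_mul_eq_sum_filter_add_sum f y {i, j} fun t ht => by
      rw [Finset.mem_insert, Finset.mem_singleton, not_or] at ht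
      exact (hint t ht.1 ht.2).2
    have hc := hy 1
    simp only [Finset.mem_insert, Finset.mem_singleton, not_or, and_assoc, ← ne_eq,
      Finset.sum_pair hij, Pi.one_apply, one_mul, Finset.sum_const, nsmul_eq_mul,
      mul_one] at hx hy hc
    have hpos : ∀ t, ¬ ((x t = 0 ∨ x t = 1) ∧ (y t = 0 ∨ y t = 1)) → 0 < x t := by
      intro t ht
      obtain ⟨h1, h2, -⟩ := hbox t
      refine lt_of_le_of_ne (h1.trans h2) fun h => ht ⟨Or.inl h.symm, Or.inl ?_⟩
      linarith
    have hlt_one : ∀ t, ¬ ((x t = 0 ∨ x t = 1) ∧ (y t = 0 ∨ y t = 1)) → y t = 0 → x t < 1 :=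
      fun t ht h => lt_of_le_of_ne (hbox t).2.2 fun h' => ht ⟨Or.inr h', Or.inl h⟩
    have hypos : 0 < y i + y j := by
      by_contra! hy0
      have hyi : y i = 0 := by linarith [(hbox i).1, (hbox j).1]
      have hyj : y j = 0 := by linarith [(hbox i).1, (hbox j).1]
      exact (relaxedKnapsack_extremePoints_tight hext hij (hpos i hi) (hlt_one i hi hyi)
        (hpos j hj) (hlt_one j hj hyj)).2 ⟨hyi, hyj⟩
    have hcardT : (Finset.univ.filter fun t => t ≠ i ∧ t ≠ j ∧ y t = 1).card + 1 ≤ k := by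
      rw [hc] at hcard
      exact_mod_cast (by linarith :
        ((Finset.univ.filter fun t => t ≠ i ∧ t ≠ j ∧ y t = 1).card : ℝ) < k)
    have hone : 1 ≤ x i + x j := by
      by_contra! hlt
      have h := (relaxedKnapsack_extremePoints_tight hext hij (hpos i hi)
        (by linarith [hpos j hj]) (hpos j hj) (by linarith [hpos i hi])).1
      rw [hc] at h
      have h' : ((Finset.univ.filter fun t => t ≠ i ∧ t ≠ j ∧ y t = 1).card : ℝ) + 1 ≤ k := by
        exact_mod_cast hcardT
      linarith [(hbox i).2.1, (hbox j).2.1]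
    refine ⟨(hFeas _ _).2 ⟨Finset.insert_subset_insert _ <|
      Finset.monotone_filter_right _ fun t _ h => ⟨h.1, h.2.1, hsub t h.2.2⟩, ?_, ?_⟩,
      hsingle j, hmax ?_⟩
    · rw [Finset.sum_insert (by simp), Finset.sum_insert (by simp)]
      rw [hx, hy] at hweight
      linarith [hle i, hle j, mul_le_mul_of_nonneg_right hwij (hpos j hj).le,
        mul_le_mul_of_nonneg_left hone (sub_nonneg.2 (hw i).2)]
    · rw [Finset.card_insert_of_notMem (by simp)]
      exact hcardT
    · rw [Finset.sum_insert (by simp)]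
      rw [hx] at hval
      linarith [hpx i, hpx j]
end
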